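/- arXiv:2302.11062 — 4 statements merged into one kernel-verified Lean document; each statement's English description precedes it below -/
import Mathlib

section
/- Let s : {1,…,n} → {1,…,n} be a permutation such that the augmented predicted values are sorted, v_{s_1} ≤ ⋯ ≤ v_{s_n}, where v_i = ŷ_i + m·I[y_i = −1]. Then for every index k with y_{s_k} = −1, the full hinged loss of the negative example s_k against all positive examples equals the partial unhinged sum over positive examples appearing at or before position k in the sorted order: Σ_{j∈I⁺} (max(m − (ŷ_j − ŷ_{s_k}), 0))² = Σ_{i=1}^{k} I[y_{s_i} = 1]·(ŷ_{s_k} + m − ŷ_{s_i})². -/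
/-- if `s` is a permutation sorting the augmented predicted values
`v_i = ŷ_i + m·I[y_i = −1]` into nondecreasing order, then for every sorted position
`k` holding a negative example, the full hinged loss of `s k` against all positive
examples equals the partial unhinged sum over positive examples at positions `≤ k`. -/
theorem squared_hinge_negative_example_partial_sum
    (n : ℕ) (yhat : Fin n → ℝ) (y : Fin n → ℤ)
    (hy : ∀ i, y i = 1 ∨ y i = -1) (m : ℝ) (hm : 0 ≤ m)
    (s : Equiv.Perm (Fin n))
    (hsort : ∀ i j : Fin n, i ≤ j →
      yhat (s i) + m * (if y (s i) = -1 then 1 else 0)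
        ≤ yhat (s j) + m * (if y (s j) = -1 then 1 else 0))
    (k : Fin n) (hk : y (s k) = -1) :
    ∑ j ∈ Finset.univ.filter (fun i => y i = 1),
        (max (m - (yhat j - yhat (s k))) 0) ^ 2
    = ∑ i ∈ Finset.Iic k,
        (if y (s i) = 1 then (yhat (s k) + m - yhat (s i)) ^ 2 else 0) := by
  rw [Finset.sum_filter, ← Equiv.sum_comp s,
    ← Finset.sum_subset (Finset.subset_univ (Finset.Iic k))]
  · refine Finset.sum_congr rfl fun i hi => ?_
    split_ifs with h
    · have hv := hsort i k (Finset.mem_Iic.mp hi)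
      norm_num [h, hk] at hv
      rw [max_eq_left (by linarith)]
      ring
    · rfl
  · intro i _ hi
    split_ifs with h
    · have hv := hsort k i (le_of_not_ge fun hik => hi (Finset.mem_Iic.mpr hik))
      norm_num [h, hk] at hv
      rw [max_eq_right (by linarith)]
      norm_num
    · rfl
end

section
/- Let s : {1,…,n} → {1,…,n} be a permutation such that v_{s_1} ≤ ⋯ ≤ v_{s_n}, where v_i = ŷ_i + m·I[y_i = −1]. Define H_k(x) = Σ_{i=1}^{k} I[y_{s_i} = 1]·(x + m − ŷ_{s_i})². Then the total squared hinge loss over all pairs of positive and negative examples can be rewritten as a single sum over sorted positions evaluated at negative examples: Σ_{k∈I⁻} Σ_{j∈I⁺} (max(m − (ŷ_j − ŷ_k), 0))² = Σ_{k=1}^{n} I[y_{s_k} = −1]·H_k(ŷ_{s_k}). -/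
/-- with `s` a permutation sorting the augmented predicted values
`v_i = ŷ_i + m·I[y_i = −1]` into nondecreasing order, and
`H_k(x) = Σ_{i≤k} I[y_{s_i} = 1]·(x + m − ŷ_{s_i})²`, the total squared hinge loss
over all pairs equals `Σ_k I[y_{s_k} = −1]·H_k(ŷ_{s_k})`. -/
theorem squared_hinge_total_eq_sorted_single_sum
    (n : ℕ) (yhat : Fin n → ℝ) (y : Fin n → ℤ)
    (hy : ∀ i, y i = 1 ∨ y i = -1) (m : ℝ) (hm : 0 ≤ m)
    (s : Equiv.Perm (Fin n))
    (hsort : ∀ i j : Fin n, i ≤ j →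
      yhat (s i) + m * (if y (s i) = -1 then 1 else 0)
        ≤ yhat (s j) + m * (if y (s j) = -1 then 1 else 0)) :
    ∑ k ∈ Finset.univ.filter (fun i => y i = -1),
      ∑ j ∈ Finset.univ.filter (fun i => y i = 1),
        (max (m - (yhat j - yhat k)) 0) ^ 2
    = ∑ k : Fin n,
        (if y (s k) = -1 then
          ∑ i ∈ Finset.Iic k,
            (if y (s i) = 1 then (yhat (s k) + m - yhat (s i)) ^ 2 else 0)
        else 0) := by
  rw [Finset.sum_filter, ← Equiv.sum_comp s]
  refine Finset.sum_congr rfl fun k _ => ?_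
  split_ifs with hk
  · rw [Finset.sum_filter, ← Equiv.sum_comp s, ← Finset.sum_subset (Finset.subset_univ (Finset.Iic k))]
    · refine Finset.sum_congr rfl fun i hi => ?_
      split_ifs with hi'
      · have h := hsort i k (Finset.mem_Iic.mp hi)
        norm_num [hk, hi'] at h
        rw [max_eq_left (by linarith)]
        ring
      · rfl
    · intro i _ hi
      split_ifs with hi'
      · have h := hsort k i (not_le.mp fun h => hi (Finset.mem_Iic.mpr h)).le
        norm_num [hk, hi'] at h
        rw [max_eq_right (by linarith)]
        norm_num
      · rfl
  · rfl
end

section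
/- (Theorem 2) Let s : {1,…,n} → {1,…,n} be a permutation such that v_{s_1} ≤ ⋯ ≤ v_{s_n}, where v_i = ŷ_i + m·I[y_i = −1]. Define recursively a_0 = b_0 = c_0 = 0, L_0 = 0, and for i = 1,…,n: a_i = a_{i−1} + I[y_{s_i} = 1], b_i = b_{i−1} + I[y_{s_i} = 1]·2(m − ŷ_{s_i}), c_i = c_{i−1} + I[y_{s_i} = 1]·(m − ŷ_{s_i})², and L_i = L_{i−1} + I[y_{s_i} = −1]·(a_i ŷ_{s_i}² + b_i ŷ_{s_i} + c_i). Then the total squared hinge loss over all pairs of positive and negative examples equals the final recursion value: Σ_{k∈I⁻} Σ_{j∈I⁺} (max(m − (ŷ_j − ŷ_k), 0))² = L_n. -/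
theorem eq_sum_ite_of_succ_eq_add {M : Type*} [AddCommMonoid M] {n : ℕ} {F : ℕ → M}
    {f : Fin n → M} (h0 : F 0 = 0) (hF : ∀ i : Fin n, F ((i : ℕ) + 1) = F i + f i)
    {k : ℕ} (hk : k ≤ n) : F k = ∑ i : Fin n, if (i : ℕ) < k then f i else 0 := by
  induction k with
  | zero => simp [h0]
  | succ k ih =>
    have hlt : (Finset.univ.filter fun i : Fin n => (i : ℕ) < k + 1)
        = insert ⟨k, hk⟩ (Finset.univ.filter fun i : Fin n => (i : ℕ) < k) := by
      ext i
      simp only [Finset.mem_filter, Finset.mem_univ, true_and, Finset.mem_insert, Fin.ext_iff]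
      omega
    rw [hF ⟨k, hk⟩, ih (by omega), ← Finset.sum_filter, ← Finset.sum_filter, hlt,
      Finset.sum_insert (by simp), add_comm]


/-- Theorem 2: with `s` a permutation sorting the augmented predicted
values `v_i = ŷ_i + m·I[y_i = −1]` into nondecreasing order, and the recursion
`a_0 = b_0 = c_0 = L_0 = 0`, `a_i = a_{i−1} + I[y_{s_i}=1]`,
`b_i = b_{i−1} + I[y_{s_i}=1]·2(m − ŷ_{s_i})`, `c_i = c_{i−1} + I[y_{s_i}=1]·(m − ŷ_{s_i})²`,
`L_i = L_{i−1} + I[y_{s_i}=−1]·(a_i ŷ_{s_i}² + b_i ŷ_{s_i} + c_i)`, the total squared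
hinge loss over all pairs of positive and negative examples equals `L_n`.
(Positions are 0-based: sorted position `i : Fin n` corresponds to step `i+1`.) -/
theorem squared_hinge_total_eq_recursion
    (n : ℕ) (yhat : Fin n → ℝ) (y : Fin n → ℤ)
    (hy : ∀ i, y i = 1 ∨ y i = -1) (m : ℝ) (hm : 0 ≤ m)
    (s : Equiv.Perm (Fin n))
    (hsort : ∀ i j : Fin n, i ≤ j →
      yhat (s i) + m * (if y (s i) = -1 then 1 else 0)
        ≤ yhat (s j) + m * (if y (s j) = -1 then 1 else 0))
    (a b c L : ℕ → ℝ)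
    (ha0 : a 0 = 0) (hb0 : b 0 = 0) (hc0 : c 0 = 0) (hL0 : L 0 = 0)
    (ha : ∀ i : Fin n, a ((i : ℕ) + 1) = a i + (if y (s i) = 1 then 1 else 0))
    (hb : ∀ i : Fin n, b ((i : ℕ) + 1)
        = b i + (if y (s i) = 1 then 2 * (m - yhat (s i)) else 0))
    (hc : ∀ i : Fin n, c ((i : ℕ) + 1)
        = c i + (if y (s i) = 1 then (m - yhat (s i)) ^ 2 else 0))
    (hL : ∀ i : Fin n, L ((i : ℕ) + 1)
        = L i + (if y (s i) = -1 then
            a ((i : ℕ) + 1) * yhat (s i) ^ 2 + b ((i : ℕ) + 1) * yhat (s i)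
              + c ((i : ℕ) + 1)
          else 0)) :
    ∑ k ∈ Finset.univ.filter (fun i => y i = -1),
      ∑ j ∈ Finset.univ.filter (fun i => y i = 1),
        (max (m - (yhat j - yhat k)) 0) ^ 2
    = L n := by
  rw [eq_sum_ite_of_succ_eq_add hL0 hL le_rfl, Finset.sum_filter, ← Equiv.sum_comp s]
  refine Finset.sum_congr rfl fun i _ => ?_
  rw [if_pos i.isLt]
  split_ifs with hi
  swap
  · rfl
  rw [eq_sum_ite_of_succ_eq_add ha0 ha i.isLt, eq_sum_ite_of_succ_eq_add hb0 hb i.isLt,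
    eq_sum_ite_of_succ_eq_add hc0 hc i.isLt, Finset.sum_mul, Finset.sum_mul,
    ← Finset.sum_add_distrib, ← Finset.sum_add_distrib, Finset.sum_filter, ← Equiv.sum_comp s]
  refine Finset.sum_congr rfl fun j _ => ?_
  by_cases hj : y (s j) = 1
  · have hj' : y (s j) ≠ -1 := by omega
    by_cases hji : (j : ℕ) < i + 1
    · have h := hsort j i (Fin.le_def.mpr (by omega))
      simp only [hi, hj', if_true, if_false] at h
      simp only [hj, hji, if_true]
      rw [max_eq_left (by linarith)]
      ring
    · have h := hsort i j (Fin.le_def.mpr (by omega))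
      simp only [hi, hj', if_true, if_false] at h
      simp only [hj, hji, if_true, if_false]
      rw [max_eq_right (by linarith)]
      ring
  · simp [hj]
end

section
/- Let s : {1,…,n} → {1,…,n} be a permutation such that v_{s_1} ≤ ⋯ ≤ v_{s_n}, where v_i = ŷ_i + m·I[y_i = −1]. If the example at the last sorted position is negative, y_{s_n} = −1, then its squared hinge loss against all positive examples has no active hinge and equals the full quadratic: Σ_{j∈I⁺} (max(m − (ŷ_j − ŷ_{s_n}), 0))² = A ŷ_{s_n}² + B ŷ_{s_n} + C, where A = |I⁺|, B = Σ_{j∈I⁺} 2(m − ŷ_j), and C = Σ_{j∈I⁺} (m − ŷ_j)². -/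
/-- with `s` a permutation sorting the augmented predicted values
`v_i = ŷ_i + m·I[y_i = −1]` into nondecreasing order, if the example at the last
sorted position is negative then its squared hinge loss against all positive examples
has no active hinge and equals the full quadratic `A ŷ² + B ŷ + C`, where
`A = |I⁺|`, `B = Σ_{j∈I⁺} 2(m − ŷ_j)`, `C = Σ_{j∈I⁺} (m − ŷ_j)²`. -/
theorem last_sorted_negative_no_hinge
    (n : ℕ) (hn : 0 < n) (yhat : Fin n → ℝ) (y : Fin n → ℤ)
    (hy : ∀ i, y i = 1 ∨ y i = -1) (m : ℝ) (hm : 0 ≤ m)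
    (s : Equiv.Perm (Fin n))
    (hsort : ∀ i j : Fin n, i ≤ j →
      yhat (s i) + m * (if y (s i) = -1 then 1 else 0)
        ≤ yhat (s j) + m * (if y (s j) = -1 then 1 else 0))
    (hlast : y (s ⟨n - 1, Nat.sub_lt hn Nat.one_pos⟩) = -1) :
    ∑ j ∈ Finset.univ.filter (fun i => y i = 1),
        (max (m - (yhat j - yhat (s ⟨n - 1, Nat.sub_lt hn Nat.one_pos⟩))) 0) ^ 2
    = ((Finset.univ.filter (fun i => y i = 1)).card : ℝ)
          * yhat (s ⟨n - 1, Nat.sub_lt hn Nat.one_pos⟩) ^ 2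
      + (∑ j ∈ Finset.univ.filter (fun i => y i = 1), 2 * (m - yhat j))
          * yhat (s ⟨n - 1, Nat.sub_lt hn Nat.one_pos⟩)
      + ∑ j ∈ Finset.univ.filter (fun i => y i = 1), (m - yhat j) ^ 2 := by
  set k : Fin n := ⟨n - 1, Nat.sub_lt hn Nat.one_pos⟩
  rw [← nsmul_eq_mul, ← Finset.sum_const, Finset.sum_mul, ← Finset.sum_add_distrib,
    ← Finset.sum_add_distrib]
  refine Finset.sum_congr rfl fun j hj => ?_
  have hyj : y j = 1 := (Finset.mem_filter.mp hj).2
  have hle : s.symm j ≤ k := Fin.le_def.mpr (Nat.le_sub_one_of_lt (s.symm j).isLt)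
  have hv := hsort (s.symm j) k hle
  rw [Equiv.apply_symm_apply, hyj, hlast] at hv
  norm_num at hv
  rw [max_eq_left (by linarith)]
  ring
end
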